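/- Let n ≥ 1 and let b_1 ≥ b_2 ≥ … ≥ b_n be positive integers. Let P = {(x, y, z_1,…,z_n) ∈ ℝ^{n+2} : 0 ≤ x ≤ 1, 0 ≤ y ≤ 1, and max(b_i x, b_i y) ≤ z_i ≤ min(1 + b_i x, 1 + b_i y) for all i}. Then the Lebesgue volume of P equals 2(A + B), where A = (1 − 1/b_1) Σ_{i=1}^{n} (−1)^{i−1} S_{i−1}(b_2,…,b_n)/(i(i+1)b_1^{i}) and B = 2 Σ_{i=1}^{n} (−1)^{i−1} S_{i−1}(b_2,…,b_n)/(i(i+1)(i+2)b_1^{i+1}). In particular, if b_1 = 1 the volume equals 2B. (By Von Korff's theorem this volume is the F-signature of the intersection algebra B(b, b).) -/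

import Mathlib

open Finset MeasureTheory

/-- `S_j(b_2,…,b_n)`: the elementary symmetric polynomial of degree `j` evaluated at the
tail entries `b_2,…,b_n` (indices `i ≠ 0` of `b : Fin n → ℕ`), as a real number. -/
noncomputable def esymmTail (n : ℕ) (b : Fin n → ℕ) (j : ℕ) : ℝ :=
  (((Finset.univ.filter (fun i : Fin n => (i : ℕ) ≠ 0)).val.map
    (fun i => (b i : ℝ))).esymm j)

/-- `A = (1 - 1/b_1) Σ_{i=1}^n (-1)^{i-1} S_{i-1}(b_2,…,b_n)/(i(i+1)b_1^i)`. -/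
noncomputable def Aval (n : ℕ) (hn : 1 ≤ n) (b : Fin n → ℕ) : ℝ :=
  (1 - 1 / (b ⟨0, hn⟩ : ℝ)) *
    ∑ j ∈ Finset.range n, (-1 : ℝ) ^ j * esymmTail n b j /
      (((j : ℝ) + 1) * ((j : ℝ) + 2) * (b ⟨0, hn⟩ : ℝ) ^ (j + 1))

/-- `B = 2 Σ_{i=1}^n (-1)^{i-1} S_{i-1}(b_2,…,b_n)/(i(i+1)(i+2)b_1^{i+1})`. -/
noncomputable def Bval (n : ℕ) (hn : 1 ≤ n) (b : Fin n → ℕ) : ℝ :=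
  2 * ∑ j ∈ Finset.range n, (-1 : ℝ) ^ j * esymmTail n b j /
      (((j : ℝ) + 1) * ((j : ℝ) + 2) * ((j : ℝ) + 3) * (b ⟨0, hn⟩ : ℝ) ^ (j + 2))

/-- Fubini for a measurable subset of `ℝ ^ (m + 1)`, slicing along the first coordinate. -/
theorem volume_eq_lintegral_volume_cons {m : ℕ} {s : Set (Fin (m + 1) → ℝ)}
    (hs : MeasurableSet s) :
    volume s = ∫⁻ x : ℝ, volume {q : Fin m → ℝ | (Fin.cons x q : Fin (m + 1) → ℝ) ∈ s} := by
  have h := (volume_preserving_piFinSuccAbove (fun _ : Fin (m + 1) => ℝ) 0).symm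
  rw [← h.measure_preimage_equiv s, Measure.volume_eq_prod, Measure.prod_apply]
  · refine lintegral_congr fun x => congrArg _ ?_
    ext q
    simp [MeasurableEquiv.piFinSuccAbove, Fin.insertNthEquiv]
  · exact (MeasurableEquiv.measurable _) hs

/-- A continuous function of `|x - y|` integrated over the unit square. -/
theorem lintegral_unitSquare_abs_sub {g : ℝ → ℝ} (hg : Continuous g) (h0 : ∀ t, 0 ≤ g t) :
    ∫⁻ x in Set.Icc (0 : ℝ) 1, ∫⁻ y in Set.Icc (0 : ℝ) 1, ENNReal.ofReal (g |x - y|) =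
      ENNReal.ofReal (2 * ∫ t in (0 : ℝ)..1, (1 - t) * g t) := by
  set G : ℝ → ℝ := fun x => ∫ t in (0 : ℝ)..x, g t with hG
  have hGd : ∀ x, HasDerivAt G (g x) x := fun x =>
    intervalIntegral.integral_hasDerivAt_right (hg.intervalIntegrable _ _)
      hg.aestronglyMeasurable.stronglyMeasurableAtFilter hg.continuousAt
  have hGc : Continuous G := continuous_iff_continuousAt.2 fun x => (hGd x).continuousAt
  have hin : ∀ x ∈ Set.Icc (0 : ℝ) 1,
      ∫⁻ y in Set.Icc (0 : ℝ) 1, ENNReal.ofReal (g |x - y|) =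
        ENNReal.ofReal (G x + G (1 - x)) := by
    intro x hx
    have hc : Continuous fun y => g |x - y| := by fun_prop
    rw [← ofReal_integral_eq_lintegral_ofReal (hc.continuousOn.integrableOn_Icc)
      (Filter.Eventually.of_forall fun _ => h0 _), integral_Icc_eq_integral_Ioc,
      ← intervalIntegral.integral_of_le zero_le_one,
      ← intervalIntegral.integral_add_adjacent_intervals (hc.intervalIntegrable 0 x)
        (hc.intervalIntegrable x 1)]
    have h1 : ∫ y in (0 : ℝ)..x, g |x - y| = G x := by
      rw [intervalIntegral.integral_congr (g := fun y => g (x - y)),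
        intervalIntegral.integral_comp_sub_left (f := g)]
      · simp [hG]
      · intro y hy
        rw [Set.uIcc_of_le hx.1] at hy
        simp only [abs_of_nonneg (sub_nonneg.2 hy.2)]
    have h2 : ∫ y in x..1, g |x - y| = G (1 - x) := by
      rw [intervalIntegral.integral_congr (g := fun y => g (y - x)),
        intervalIntegral.integral_comp_sub_right (f := g)]
      · simp [hG]
      · intro y hy
        rw [Set.uIcc_of_le hx.2] at hy
        simp only [abs_sub_comm x y, abs_of_nonneg (sub_nonneg.2 hy.1)]
    rw [h1, h2]
  have hG0 : ∀ x, 0 ≤ x → 0 ≤ G x := fun x hx =>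
    intervalIntegral.integral_nonneg hx fun _ _ => h0 _
  have hGc' : Continuous fun x => G (1 - x) := by fun_prop
  have hsum : Continuous fun x => G x + G (1 - x) := hGc.add hGc'
  rw [setLIntegral_congr_fun measurableSet_Icc hin,
    ← ofReal_integral_eq_lintegral_ofReal hsum.continuousOn.integrableOn_Icc
      ((ae_restrict_iff' measurableSet_Icc).2 <| Filter.Eventually.of_forall fun x hx =>
        add_nonneg (hG0 x hx.1) (hG0 _ (sub_nonneg.2 hx.2))),
    integral_Icc_eq_integral_Ioc, ← intervalIntegral.integral_of_le zero_le_one,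
    intervalIntegral.integral_add (hGc.intervalIntegrable _ _) (hGc'.intervalIntegrable _ _),
    intervalIntegral.integral_comp_sub_left (f := G)]
  have hparts := intervalIntegral.integral_mul_deriv_eq_deriv_mul (a := 0) (b := 1)
    (u := fun t : ℝ => 1 - t) (u' := fun _ => -1) (v := G) (v' := g)
    (fun x _ => (hasDerivAt_id x).const_sub 1) (fun x _ => hGd x)
    (continuous_const.intervalIntegrable _ _) (hg.intervalIntegrable _ _)
  have hG00 : G 0 = 0 := by simp [hG]
  rw [hparts]
  congr 1
  simp [hG00]
  ring

/-- Expansion of a product of linear factors through elementary symmetric polynomials. -/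
theorem prod_one_sub_mul_eq_sum_esymm {σ : Type*} (s : Finset σ) (f : σ → ℝ) (t : ℝ) :
    ∏ i ∈ s, (1 - f i * t) =
      ∑ j ∈ range (s.card + 1), (-1 : ℝ) ^ j * (s.val.map f).esymm j * t ^ j := by
  simp_rw [sub_eq_add_neg]
  rw [prod_one_add, sum_powerset]
  refine sum_congr rfl fun j _ => ?_
  rw [esymm_map_val, mul_sum, sum_mul]
  refine sum_congr rfl fun u hu => ?_
  rw [prod_neg, prod_mul_distrib, prod_const, (mem_powersetCard.1 hu).2]
  ring

theorem integral_one_sub_mul_one_sub_mul_pow {c : ℝ} (hc : 0 < c) (j : ℕ) :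
    ∫ t in (0 : ℝ)..1 / c, (1 - t) * (1 - c * t) * t ^ j =
      (1 - 1 / c) / (((j : ℝ) + 1) * ((j : ℝ) + 2) * c ^ (j + 1)) +
        2 / (((j : ℝ) + 1) * ((j : ℝ) + 2) * ((j : ℝ) + 3) * c ^ (j + 2)) := by
  have h : ∀ t : ℝ, (1 - t) * (1 - c * t) * t ^ j =
      t ^ j - (1 + c) * t ^ (j + 1) + c * t ^ (j + 2) := fun t => by ring
  have hi : ∀ (a : ℝ) (k : ℕ),
      IntervalIntegrable (fun t : ℝ => a * t ^ k) volume 0 (1 / c) := fun a k =>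
    Continuous.intervalIntegrable (by fun_prop) _ _
  have hi' := hi 1 j
  simp only [one_mul] at hi'
  simp_rw [h]
  rw [intervalIntegral.integral_add (hi'.sub (hi _ _)) (hi _ _),
    intervalIntegral.integral_sub hi' (hi _ _), intervalIntegral.integral_const_mul,
    intervalIntegral.integral_const_mul, integral_pow, integral_pow, integral_pow]
  have h1 : (j : ℝ) + 1 ≠ 0 := by positivity
  have h2 : (j : ℝ) + 2 ≠ 0 := by positivity
  have h3 : (j : ℝ) + 3 ≠ 0 := by positivity
  have h2' : (j : ℝ) + 1 + 1 ≠ 0 := by positivity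
  have h3' : (j : ℝ) + 2 + 1 ≠ 0 := by positivity
  push_cast
  simp only [one_div, inv_pow, ne_eq, Nat.add_eq_zero_iff, one_ne_zero, and_false,
    not_false_eq_true, zero_pow, sub_zero, OfNat.ofNat_ne_zero]
  rw [show (j : ℝ) + 1 + 1 = j + 2 by ring, show (j : ℝ) + 2 + 1 = j + 3 by ring]
  field_simp
  ring

theorem integral_one_sub_mul_prod_max (n : ℕ) (hn : 1 ≤ n) (b : Fin n → ℕ)
    (hb : ∀ i, 0 < b i) (hmono : ∀ i j : Fin n, i ≤ j → b j ≤ b i) :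
    ∫ t in (0 : ℝ)..1, (1 - t) * ∏ i, max 0 (1 - (b i : ℝ) * t) =
      Aval n hn b + Bval n hn b := by
  set z : Fin n := ⟨0, hn⟩ with hz
  set c : ℝ := (b z : ℝ) with hcdef
  have hc1 : (1 : ℝ) ≤ c := Nat.one_le_cast.2 (hb z)
  have hc : 0 < c := by linarith
  have hbc : ∀ i, (b i : ℝ) ≤ c := fun i =>
    Nat.cast_le.2 (hmono z i (Fin.mk_le_of_le_val (Nat.zero_le _)))
  have hcle : 1 / c ≤ 1 := (div_le_one hc).2 hc1
  have hcpos : 0 ≤ 1 / c := by positivity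
  have hcont : Continuous fun t : ℝ => (1 - t) * ∏ i, max 0 (1 - (b i : ℝ) * t) := by fun_prop
  rw [← intervalIntegral.integral_add_adjacent_intervals
    (hcont.intervalIntegrable 0 (1 / c)) (hcont.intervalIntegrable (1 / c) 1)]
  have htail : ∫ t in (1 / c)..1, (1 - t) * ∏ i, max 0 (1 - (b i : ℝ) * t) = 0 := by
    rw [intervalIntegral.integral_congr (g := fun _ => (0 : ℝ))]
    · simp
    · intro t ht
      rw [Set.uIcc_of_le hcle] at ht
      have : 1 ≤ c * t := by
        have := (div_le_iff₀ hc).1 ht.1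
        linarith
      simp only
      have hz0 : max 0 (1 - (b z : ℝ) * t) = 0 := max_eq_left (by linarith)
      rw [prod_eq_zero (f := fun i => max 0 (1 - (b i : ℝ) * t)) (mem_univ z) hz0, mul_zero]
  set s : Finset (Fin n) := univ.filter (fun i : Fin n => (i : ℕ) ≠ 0) with hs
  have hse : s = univ.erase z := by
    ext i
    simp [hs, hz, Fin.ext_iff]
  have hcard : s.card + 1 = n := by
    rw [hse, card_erase_of_mem (mem_univ z), card_univ, Fintype.card_fin]
    omega
  have hhead : Set.EqOn (fun t : ℝ => (1 - t) * ∏ i, max 0 (1 - (b i : ℝ) * t))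
      (fun t => ∑ j ∈ range n,
        ((-1 : ℝ) ^ j * esymmTail n b j) * ((1 - t) * (1 - c * t) * t ^ j))
      (Set.uIcc 0 (1 / c)) := by
    intro t ht
    rw [Set.uIcc_of_le hcpos] at ht
    have ht1 : c * t ≤ 1 := by
      have := (le_div_iff₀ hc).1 ht.2
      linarith
    have hmax : ∀ i, max 0 (1 - (b i : ℝ) * t) = 1 - (b i : ℝ) * t := fun i =>
      max_eq_right (by nlinarith [hbc i, ht.1])
    simp only [hmax]
    rw [← mul_prod_erase univ _ (mem_univ z), ← hse, prod_one_sub_mul_eq_sum_esymm, hcard,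
      ← mul_assoc, mul_sum]
    refine sum_congr rfl fun j _ => ?_
    rw [esymmTail, ← hs]
    ring
  rw [htail, add_zero, intervalIntegral.integral_congr hhead,
    intervalIntegral.integral_finsetSum fun j _ =>
      Continuous.intervalIntegrable (by fun_prop) _ _]
  simp_rw [intervalIntegral.integral_const_mul, integral_one_sub_mul_one_sub_mul_pow hc]
  rw [Aval, Bval, ← hz, ← hcdef, mul_sum, mul_sum, ← sum_add_distrib]
  refine sum_congr rfl fun j _ => ?_
  ring

/-- for positive integers `b_1 ≥ … ≥ b_n`, the volume of
`P = {(x,y,z_1,…,z_n) : 0 ≤ x,y ≤ 1, max(bᵢx, bᵢy) ≤ zᵢ ≤ min(1 + bᵢx, 1 + bᵢy)}` equals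
`2(A + B)`; in particular it equals `2B` when `b_1 = 1`.  By Von Korff's theorem this is the
F-signature of the intersection algebra `B(b, b)`. -/
theorem volume_Fsignature_region_bb (n : ℕ) (hn : 1 ≤ n) (b : Fin n → ℕ)
    (hb : ∀ i, 0 < b i) (hmono : ∀ i j : Fin n, i ≤ j → b j ≤ b i)
    (P : Set (Fin (n + 2) → ℝ))
    (hP : P = {p | 0 ≤ p 0 ∧ p 0 ≤ 1 ∧ 0 ≤ p 1 ∧ p 1 ≤ 1 ∧
      ∀ i : Fin n,
        max ((b i : ℝ) * p 0) ((b i : ℝ) * p 1) ≤ p i.succ.succ ∧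
        p i.succ.succ ≤ min (1 + (b i : ℝ) * p 0) (1 + (b i : ℝ) * p 1)}) :
    volume P = ENNReal.ofReal (2 * (Aval n hn b + Bval n hn b)) ∧
    (b ⟨0, hn⟩ = 1 → volume P = ENNReal.ofReal (2 * Bval n hn b)) := by
  have hclosed : IsClosed P := by
    rw [hP]
    simp only [Set.ofPred_and, Set.ofPred_forall]
    refine (isClosed_le (by fun_prop) (by fun_prop)).inter <|
      (isClosed_le (by fun_prop) (by fun_prop)).inter <|
      (isClosed_le (by fun_prop) (by fun_prop)).inter <|
      (isClosed_le (by fun_prop) (by fun_prop)).inter <| isClosed_iInter fun i =>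
      (isClosed_le (by fun_prop) (by fun_prop)).inter (isClosed_le (by fun_prop) (by fun_prop))
  have hslice : ∀ x y : ℝ,
      volume {r : Fin n → ℝ |
        (Fin.cons x (Fin.cons y r : Fin (n + 1) → ℝ) : Fin (n + 2) → ℝ) ∈ P} =
      (Set.Icc (0 : ℝ) 1).indicator (fun x => (Set.Icc (0 : ℝ) 1).indicator
        (fun y => ENNReal.ofReal (∏ i, max 0 (1 - (b i : ℝ) * |x - y|))) y) x := by
    intro x y
    have hset : {r : Fin n → ℝ |
        (Fin.cons x (Fin.cons y r : Fin (n + 1) → ℝ) : Fin (n + 2) → ℝ) ∈ P} =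
        {r | x ∈ Set.Icc (0 : ℝ) 1 ∧ y ∈ Set.Icc (0 : ℝ) 1 ∧
          r ∈ Set.Icc (fun i => max ((b i : ℝ) * x) ((b i : ℝ) * y))
            (fun i => min (1 + (b i : ℝ) * x) (1 + (b i : ℝ) * y))} := by
      ext r
      have h1 : (Fin.cons x (Fin.cons y r : Fin (n + 1) → ℝ) : Fin (n + 2) → ℝ) 1 = y := rfl
      simp only [hP, Set.mem_ofPred_eq, h1, Fin.cons_zero, Fin.cons_succ, Set.mem_Icc,
        Pi.le_def, forall_and, and_assoc]
    rw [hset]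
    by_cases hx : x ∈ Set.Icc (0 : ℝ) 1
    · by_cases hy : y ∈ Set.Icc (0 : ℝ) 1
      · simp only [hx, hy, true_and, Set.ofPred_mem_eq, Set.indicator_of_mem]
        rw [Real.volume_Icc_pi, ENNReal.ofReal_prod_of_nonneg fun i _ => le_max_left _ _]
        refine prod_congr rfl fun i _ => ?_
        have hi : min (1 + (b i : ℝ) * x) (1 + (b i : ℝ) * y) -
            max ((b i : ℝ) * x) ((b i : ℝ) * y) = 1 - (b i : ℝ) * |x - y| := by
          rw [min_add_add_left, ← abs_of_nonneg (Nat.cast_nonneg (α := ℝ) (b i)), ← abs_mul,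
            abs_of_nonneg (Nat.cast_nonneg (α := ℝ) (b i)), mul_sub, ← max_sub_min_eq_abs']
          ring
        rw [hi, ENNReal.ofReal_max, ENNReal.ofReal_zero, max_eq_right zero_le]
      · simp [hy]
    · simp [hx]
  have hvol : volume P = ENNReal.ofReal (2 * (Aval n hn b + Bval n hn b)) := by
    rw [volume_eq_lintegral_volume_cons hclosed.measurableSet]
    have hinner : ∀ x : ℝ,
        volume {q : Fin (n + 1) → ℝ | (Fin.cons x q : Fin (n + 2) → ℝ) ∈ P} =
        (Set.Icc (0 : ℝ) 1).indicator (fun x => ∫⁻ y in Set.Icc (0 : ℝ) 1,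
          ENNReal.ofReal (∏ i, max 0 (1 - (b i : ℝ) * |x - y|))) x := by
      intro x
      have hmeas : MeasurableSet {q : Fin (n + 1) → ℝ | (Fin.cons x q : Fin (n + 2) → ℝ) ∈ P} :=
        (hclosed.preimage (by fun_prop :
          Continuous fun q : Fin (n + 1) → ℝ => (Fin.cons x q : Fin (n + 2) → ℝ))).measurableSet
      rw [volume_eq_lintegral_volume_cons hmeas]
      simp only [Set.mem_ofPred_eq, hslice]
      by_cases hx : x ∈ Set.Icc (0 : ℝ) 1
      · simp only [hx, Set.indicator_of_mem]
        exact lintegral_indicator measurableSet_Icc _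
      · simp [hx]
    rw [lintegral_congr hinner, lintegral_indicator measurableSet_Icc,
      lintegral_unitSquare_abs_sub (g := fun t => ∏ i, max 0 (1 - (b i : ℝ) * t)) (by fun_prop)
        (fun t => prod_nonneg fun i _ => le_max_left _ _),
      integral_one_sub_mul_prod_max n hn b hb hmono]
  refine ⟨hvol, fun h => ?_⟩
  rw [hvol]
  simp [Aval, h]
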